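/- Let V ⊆ ℝ⁺ with 0 ∈ V, let s assign to each r ∈ V* a cardinal s(r) ≥ 2, and let J ⊆ Bound(V) be an initial segment of (𝒫(V*), ⊆) (i.e., closed under taking subsets). Set J̃ := {A ∈ Bound(V) : [a,∞) ∩ A ∈ J for every real a > 0}. Then M_s(J̃) is the Cauchy completion of M_s(J): V_s(J) is topologically dense in M_s(J̃), and M_s(J̃) is Cauchy complete. -/

import Mathlib

universe u

open Cardinal

/-- A point of the space `M_s(J)`: a function `f` defined on `V* = V \ {0}` such that
`f r` is an element of the cardinal `s r` (viewed as an initial ordinal), whose support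
`{r ∈ V* | f r ≠ 0}` belongs to the collection `J`.  (The function is extended by `0`
outside `V*`.) -/
structure MsPoint (V : Set ℝ) (s : ℝ → Cardinal.{u}) (J : Set (Set ℝ)) :
    Type (u + 1) where
  toFun : ℝ → Ordinal.{u}
  lt_ord : ∀ r ∈ V \ {0}, toFun r < (s r).ord
  eq_zero : ∀ r ∉ V \ {0}, toFun r = 0
  supp_mem : {r | r ∈ V \ {0} ∧ toFun r ≠ 0} ∈ J

/-- The ultrametric distance on `M_s(J)`:
`d(f, g) = sup {r ∈ V* | f r ≠ g r}` (with `sup ∅ = 0`). -/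
noncomputable def msDist {V : Set ℝ} {s : ℝ → Cardinal.{u}} {J : Set (Set ℝ)}
    (f g : MsPoint V s J) : ℝ :=
  sSup {r | r ∈ V \ {0} ∧ f.toFun r ≠ g.toFun r}

/-- `Bound(V)`: the subsets of `V* = V \ {0}` which are bounded above in `ℝ`. -/
def BoundSets (V : Set ℝ) : Set (Set ℝ) := {A | A ⊆ V \ {0} ∧ BddAbove A}

/-- `Fin(V)`: the finite subsets of `V* = V \ {0}`. -/
def FinSets (V : Set ℝ) : Set (Set ℝ) := {A | A ⊆ V \ {0} ∧ A.Finite}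

/-- `Well(V)`: the subsets of `V* = V \ {0}` which are well-ordered under `≥`
(equivalently, on which `>` is well-founded). -/
def WellSets (V : Set ℝ) : Set (Set ℝ) :=
  {A | A ⊆ V \ {0} ∧ A.WellFoundedOn (· > · : ℝ → ℝ → Prop)}

/-- `J̃`: the subsets `A ∈ Bound(V)` such that `[a, ∞) ∩ A ∈ J` for every real `a > 0`. -/
def tildeSets (V : Set ℝ) (J : Set (Set ℝ)) : Set (Set ℝ) :=
  {A | A ∈ BoundSets V ∧ ∀ a : ℝ, 0 < a → Set.Ici a ∩ A ∈ J}

namespace MsPoint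

variable {V : Set ℝ} {s : ℝ → Cardinal.{u}} {J : Set (Set ℝ)}

/-- The support of a point of `M_s(J)`. -/
def supp (f : MsPoint V s J) : Set ℝ := {r | r ∈ V \ {0} ∧ f.toFun r ≠ 0}

theorem toFun_eq_of_msDist_lt (hJ : J ⊆ BoundSets V) {f g : MsPoint V s J} {r : ℝ}
    (h : msDist f g < r) : f.toFun r = g.toFun r := by
  by_cases hr : r ∈ V \ {0}
  · by_contra hne
    have hbdd : BddAbove {r | r ∈ V \ {0} ∧ f.toFun r ≠ g.toFun r} := by
      refine ((hJ f.supp_mem).2.union (hJ g.supp_mem).2).mono ?_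
      rintro x ⟨hx, hfg⟩
      by_cases hf : f.toFun x = 0
      · exact Or.inr ⟨hx, fun hg => hfg (hf.trans hg.symm)⟩
      · exact Or.inl ⟨hx, hf⟩
    exact (le_csSup hbdd ⟨hr, hne⟩).not_gt h
  · rw [f.eq_zero r hr, g.eq_zero r hr]

theorem msDist_le {f g : MsPoint V s J} {a : ℝ} (ha : 0 ≤ a)
    (h : ∀ r, a ≤ r → f.toFun r = g.toFun r) : msDist f g ≤ a :=
  Real.sSup_le (fun r hr => le_of_not_ge fun har => hr.2 (h r har)) ha

end MsPoint

theorem tildeSets_subset_boundSets (V : Set ℝ) (J : Set (Set ℝ)) :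
    tildeSets V J ⊆ BoundSets V := fun _ hA => hA.1

theorem subset_tildeSets {V : Set ℝ} {J : Set (Set ℝ)} (hJB : J ⊆ BoundSets V)
    (hJdown : ∀ A ∈ J, ∀ B ⊆ A, B ∈ J) : J ⊆ tildeSets V J :=
  fun A hA => ⟨hJB hA, fun _ _ => hJdown A hA _ Set.inter_subset_right⟩

namespace MsPoint

variable {V : Set ℝ} {s : ℝ → Cardinal.{u}} {J : Set (Set ℝ)}

theorem exists_supp_mem_msDist_lt (hJB : J ⊆ BoundSets V)
    (hJdown : ∀ A ∈ J, ∀ B ⊆ A, B ∈ J) (g : MsPoint V s (tildeSets V J)) {ε : ℝ} (hε : 0 < ε) :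
    ∃ f : MsPoint V s (tildeSets V J), f.supp ∈ J ∧ msDist f g < ε := by
  classical
  have hsupp : {r | r ∈ V \ {0} ∧ (if ε / 2 ≤ r then g.toFun r else 0) ≠ 0} ∈ J := by
    refine hJdown _ (g.supp_mem.2 (ε / 2) (half_pos hε)) _ ?_
    rintro r ⟨hr, hne⟩
    by_cases h : ε / 2 ≤ r
    · exact ⟨h, hr, by simpa [h] using hne⟩
    · simp [h] at hne
  refine ⟨⟨fun r => if ε / 2 ≤ r then g.toFun r else 0, fun r hr => ?_, fun r hr => ?_,
    subset_tildeSets hJB hJdown hsupp⟩, hsupp, ?_⟩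
  · have := g.lt_ord r hr
    split_ifs
    · exact this
    · exact zero_le.trans_lt this
  · simp [g.eq_zero r hr]
  · refine (msDist_le (half_pos hε).le fun r hr => ?_).trans_lt (half_lt_self hε)
    exact if_pos hr

theorem exists_limit (w : ℕ → MsPoint V s (tildeSets V J))
    (hw : ∀ ε : ℝ, 0 < ε → ∃ N : ℕ, ∀ m ≥ N, ∀ n ≥ N, msDist (w m) (w n) < ε) :
    ∃ g : MsPoint V s (tildeSets V J),
      ∀ ε : ℝ, 0 < ε → ∃ N : ℕ, ∀ n ≥ N, msDist (w n) g < ε := by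
  have hw' : ∀ ε : ℝ, ∃ N : ℕ, 0 < ε → ∀ m ≥ N, ∀ n ≥ N, msDist (w m) (w n) < ε := fun ε => by
    by_cases hε : 0 < ε
    · exact (hw ε hε).imp fun _ h _ => h
    · exact ⟨0, fun h => absurd h hε⟩
  choose N hN using hw'
  have agree : ∀ a > 0, ∀ n ≥ N a, ∀ r ≥ a, (w n).toFun r = (w (N r)).toFun r := by
    intro a ha n hn r hr
    have hB := tildeSets_subset_boundSets V J
    have h₁ := toFun_eq_of_msDist_lt hB
      ((hN a ha n hn (max (N a) (N r)) (le_max_left _ _)).trans_le hr)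
    have h₂ := toFun_eq_of_msDist_lt hB
      (hN r (ha.trans_le hr) (max (N a) (N r)) (le_max_right _ _) (N r) le_rfl)
    exact h₁.trans h₂
  refine ⟨⟨fun r => (w (N r)).toFun r, fun r hr => (w (N r)).lt_ord r hr,
    fun r hr => (w (N r)).eq_zero r hr, ⟨fun r hr => hr.1, ?_⟩, fun a ha => ?_⟩, fun ε hε => ?_⟩
  · refine (bddAbove_Iic (a := (1 : ℝ)).union (w (N 1)).supp_mem.1.2).mono ?_
    rintro r ⟨hr, hne⟩
    rcases le_total r 1 with h | h
    · exact Or.inl h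
    · exact Or.inr ⟨hr, by rwa [agree 1 one_pos _ le_rfl r h]⟩
  · convert (w (N a)).supp_mem.2 a ha using 1
    ext r
    refine and_congr_right fun hr => and_congr_right fun _ => ?_
    rw [agree a ha _ le_rfl r hr]
  · refine ⟨N (ε / 2), fun n hn => ?_⟩
    exact (msDist_le (half_pos hε).le fun r hr => agree _ (half_pos hε) n hn r hr).trans_lt
      (half_lt_self hε)

end MsPoint

/-- Let `V ⊆ ℝ⁺` with `0 ∈ V`, let `s` assign to each `r ∈ V*` a
cardinal `s r ≥ 2`, and let `J ⊆ Bound(V)` be an initial segment of `(𝒫(V*), ⊆)`.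
Then `M_s(J̃)` is the Cauchy completion of `M_s(J)`: the points with support in `J` are
topologically dense in `M_s(J̃)`, and `M_s(J̃)` is Cauchy complete. -/
theorem stmt5 (V : Set ℝ) (hV : V ⊆ {r : ℝ | 0 ≤ r}) (h0V : (0 : ℝ) ∈ V)
    (s : ℝ → Cardinal.{u}) (hs : ∀ r ∈ V \ {0}, 2 ≤ s r)
    (J : Set (Set ℝ)) (hJB : J ⊆ BoundSets V)
    (hJdown : ∀ A ∈ J, ∀ B ⊆ A, B ∈ J) :
    (∀ g : MsPoint V s (tildeSets V J), ∀ ε : ℝ, 0 < ε →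
      ∃ f : MsPoint V s (tildeSets V J),
        {r | r ∈ V \ {0} ∧ f.toFun r ≠ 0} ∈ J ∧ msDist f g < ε) ∧
      (∀ u : ℕ → MsPoint V s (tildeSets V J),
        (∀ ε : ℝ, 0 < ε → ∃ N : ℕ, ∀ m ≥ N, ∀ n ≥ N, msDist (u m) (u n) < ε) →
        ∃ g : MsPoint V s (tildeSets V J),
          ∀ ε : ℝ, 0 < ε → ∃ N : ℕ, ∀ n ≥ N, msDist (u n) g < ε) := by
  exact ⟨fun g _ hε => g.exists_supp_mem_msDist_lt hJB hJdown hε, MsPoint.exists_limit⟩
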